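/- Let (X,d) be a compact metric space and let f : X → X be a continuous map which is ball expanding with constants 0 < L < 1 and δ₀ > 0. Let C be a chain component of f and let x ∈ X. If d(x,C) ≤ δ₀ and lim_{i→∞} d(f^i(x), C) = 0, then x ∈ C. -/

import Mathlib

open Metric Set Function

/-- A finite sequence `c 0, c 1, ..., c k` (with `k ≥ 1`) is a `δ`-chain of `f` if
`dist (f (c i)) (c (i+1)) ≤ δ` for all `0 ≤ i ≤ k-1`. -/
def IsDeltaChain {X : Type*} [MetricSpace X] (f : X → X) (δ : ℝ) (c : ℕ → X) (k : ℕ) : Prop :=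
  1 ≤ k ∧ ∀ i < k, dist (f (c i)) (c (i + 1)) ≤ δ

/-- `x → y` : for every `δ > 0` there is a `δ`-chain of `f` from `x` to `y`. -/
def ChainReach {X : Type*} [MetricSpace X] (f : X → X) (x y : X) : Prop :=
  ∀ δ : ℝ, 0 < δ → ∃ (c : ℕ → X) (k : ℕ), IsDeltaChain f δ c k ∧ c 0 = x ∧ c k = y

/-- The chain recurrent set `CR(f) = {x | x → x}`. -/
def chainRecurrentSet {X : Type*} [MetricSpace X] (f : X → X) : Set X :=
  {x | ChainReach f x x}

/-- The set of chain components of `f`: equivalence classes of `↔` on `CR(f)`. -/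
def chainComponents {X : Type*} [MetricSpace X] (f : X → X) : Set (Set X) :=
  {C | ∃ x ∈ chainRecurrentSet f,
    C = {y ∈ chainRecurrentSet f | ChainReach f x y ∧ ChainReach f y x}}

/-- `f` is ball expanding with constants `L`, `δ₀`. -/
def BallExpandingWith {X : Type*} [MetricSpace X] (f : X → X) (L δ₀ : ℝ) : Prop :=
  ∀ (x : X) (δ : ℝ), 0 < δ → δ ≤ δ₀ → closedBall (f x) δ ⊆ f '' closedBall x (L * δ)

/-- `f` is ball expanding: there are `0 < L < 1` and `δ₀ > 0` with
`B_δ(f x) ⊆ f (B_{Lδ} x)` for all `x` and `0 < δ ≤ δ₀`. -/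
def BallExpanding {X : Type*} [MetricSpace X] (f : X → X) : Prop :=
  ∃ L δ₀ : ℝ, 0 < L ∧ L < 1 ∧ 0 < δ₀ ∧ BallExpandingWith f L δ₀

/-- A closed `f`-invariant set `S` is chain stable. -/
def ChainStable {X : Type*} [MetricSpace X] (f : X → X) (S : Set X) : Prop :=
  ∀ ε : ℝ, 0 < ε → ∃ δ : ℝ, 0 < δ ∧ ∀ (c : ℕ → X) (k : ℕ),
    IsDeltaChain f δ c k → c 0 ∈ S → infDist (c k) S ≤ ε

/-- `f` has the h-shadowing property. -/
def HShadowing {X : Type*} [MetricSpace X] (f : X → X) : Prop :=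
  ∀ ε : ℝ, 0 < ε → ∃ δ : ℝ, 0 < δ ∧ ∀ (c : ℕ → X) (k : ℕ), IsDeltaChain f δ c k →
    ∃ x : X, (∀ i < k, dist (f^[i] x) (c i) ≤ ε) ∧ f^[k] x = c k

/-- `f` has the `L`-Lipschitz shadowing property with constant `δ₀`. -/
def LipschitzShadowingWith {X : Type*} [MetricSpace X] (f : X → X) (L δ₀ : ℝ) : Prop :=
  ∀ δ : ℝ, 0 < δ → δ ≤ δ₀ → ∀ ξ : ℕ → X, (∀ i : ℕ, dist (f (ξ i)) (ξ (i + 1)) ≤ δ) →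
    ∃ x : X, ∀ i : ℕ, dist (f^[i] x) (ξ i) ≤ L * δ


section ChainReach

open Filter Topology Relation

variable {X : Type*} [MetricSpace X] {f : X → X}

/-- One step of a `δ`-chain. -/
def ChainStep (f : X → X) (δ : ℝ) (x y : X) : Prop :=
  dist (f x) y ≤ δ

theorem ChainStep.mono {δ ε : ℝ} (h : δ ≤ ε) {x y : X} (hxy : ChainStep f δ x y) :
    ChainStep f ε x y :=
  le_trans hxy h

theorem transGen_chainStep_of_isDeltaChain {δ : ℝ} {c : ℕ → X} {k : ℕ}
    (h : IsDeltaChain f δ c k) : TransGen (ChainStep f δ) (c 0) (c k) := by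
  obtain ⟨hk, hc⟩ := h
  induction k, hk using Nat.le_induction with
  | base => exact .single (hc 0 one_pos)
  | succ k _ ih => exact (ih fun i hi => hc i (by omega)).tail (hc k (by omega))

theorem exists_isDeltaChain_of_transGen {δ : ℝ} {x y : X}
    (h : TransGen (ChainStep f δ) x y) :
    ∃ (c : ℕ → X) (k : ℕ), IsDeltaChain f δ c k ∧ c 0 = x ∧ c k = y := by
  induction h with
  | @single y hy =>
    refine ⟨fun i => if i = 0 then x else y, 1, ⟨le_rfl, fun i hi => ?_⟩, by simp, by simp⟩
    obtain rfl : i = 0 := by omega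
    simpa [ChainStep] using hy
  | @tail b y _ hy ih =>
    obtain ⟨c, k, ⟨hk, hc⟩, h0, hb⟩ := ih
    refine ⟨fun i => if i ≤ k then c i else y, k + 1, ⟨by omega, fun i hi => ?_⟩,
      by simpa using h0, by simp⟩
    rcases Nat.lt_succ_iff_lt_or_eq.mp hi with hi | rfl
    · simpa [hi.le, Nat.succ_le_of_lt hi] using hc i hi
    · simpa [hb, ChainStep] using hy

theorem chainReach_iff_transGen {x y : X} :
    ChainReach f x y ↔ ∀ δ : ℝ, 0 < δ → TransGen (ChainStep f δ) x y := by
  refine ⟨fun h δ hδ => ?_, fun h δ hδ => exists_isDeltaChain_of_transGen (h δ hδ)⟩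
  obtain ⟨c, k, hc, rfl, rfl⟩ := h δ hδ
  exact transGen_chainStep_of_isDeltaChain hc

theorem ChainReach.trans {x y z : X} (hxy : ChainReach f x y) (hyz : ChainReach f y z) :
    ChainReach f x z := by
  rw [chainReach_iff_transGen] at *
  exact fun δ hδ => (hxy δ hδ).trans (hyz δ hδ)

theorem chainReach_apply (x : X) : ChainReach f x (f x) :=
  chainReach_iff_transGen.mpr fun _ hδ => .single ((dist_self (f x)).trans_le hδ.le)

theorem reflTransGen_chainStep_iterate {δ : ℝ} (hδ : 0 ≤ δ) (x : X) (n : ℕ) :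
    ReflTransGen (ChainStep f δ) x (f^[n] x) := by
  induction n with
  | zero => exact .refl
  | succ n ih =>
    refine ih.tail ?_
    rw [iterate_succ_apply']
    exact (dist_self _).trans_le hδ

/-- The endpoint of a chain may be moved at the cost of a larger error. -/
theorem transGen_chainStep_of_dist_le {δ ε : ℝ} (hε : 0 ≤ ε) {x y z : X}
    (h : TransGen (ChainStep f δ) x y) (hyz : dist y z ≤ ε) :
    TransGen (ChainStep f (δ + ε)) x z := by
  obtain ⟨b, hb, hby⟩ := TransGen.tail'_iff.mp h
  refine TransGen.tail' (ReflTransGen.mono (fun _ _ => ChainStep.mono (by linarith)) _ _ hb) ?_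
  exact (dist_triangle _ y _).trans (add_le_add hby hyz)

theorem isClosed_setOf_chainReach_right (x : X) : IsClosed {y | ChainReach f x y} := by
  refine isClosed_of_closure_subset fun y hy => chainReach_iff_transGen.mpr fun δ hδ => ?_
  obtain ⟨z, hz, hyz⟩ := Metric.mem_closure_iff.mp hy (δ / 2) (half_pos hδ)
  rw [← add_halves δ]
  exact transGen_chainStep_of_dist_le (half_pos hδ).le
    (chainReach_iff_transGen.mp hz _ (half_pos hδ)) (dist_comm y z ▸ hyz.le)

theorem isClosed_setOf_chainReach_left (hf : Continuous f) (y : X) :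
    IsClosed {x | ChainReach f x y} := by
  refine isClosed_of_closure_subset fun x hx => chainReach_iff_transGen.mpr fun δ hδ => ?_
  obtain ⟨η, hη, hfη⟩ := Metric.continuous_iff.mp hf x (δ / 2) (half_pos hδ)
  obtain ⟨z, hz, hxz⟩ := Metric.mem_closure_iff.mp hx η hη
  obtain ⟨b, hzb, hby⟩ :=
    TransGen.head'_iff.mp (chainReach_iff_transGen.mp hz _ (half_pos hδ))
  refine TransGen.head' ?_ (ReflTransGen.mono (fun _ _ => ChainStep.mono (half_le_self hδ.le)) _ _ hby)
  have h₁ := hfη z (dist_comm x z ▸ hxz)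
  have h₂ : dist (f z) b ≤ δ / 2 := hzb
  rw [dist_comm] at h₁
  exact (dist_triangle _ (f z) _).trans (by linarith)

/-- A chain recurrent point has a preimage which it reaches. -/
theorem exists_apply_eq_chainReach [CompactSpace X] (hf : Continuous f) {y : X}
    (hy : ChainReach f y y) : ∃ z, f z = y ∧ ChainReach f y z := by
  have hpos : ∀ n : ℕ, (0 : ℝ) < 1 / (n + 1) := fun n => Nat.one_div_pos_of_nat
  have hpre : ∀ n : ℕ, ∃ z, TransGen (ChainStep f (1 / (n + 1))) y z ∧
      dist (f z) y ≤ 1 / (n + 1) := fun n => by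
    have h := chainReach_iff_transGen.mp hy _ (hpos n)
    obtain ⟨z, hyz, hzy⟩ := TransGen.tail'_iff.mp h
    exact ⟨z, h.trans_left hyz, hzy⟩
  choose u hu hfu using hpre
  obtain ⟨z, φ, hφ, hz⟩ := CompactSpace.tendsto_subseq u
  have hlim : Tendsto (fun n => 1 / ((φ n : ℝ) + 1)) atTop (𝓝 0) :=
    tendsto_one_div_add_atTop_nhds_zero_nat.comp hφ.tendsto_atTop
  refine ⟨z, ?_, chainReach_iff_transGen.mpr fun δ hδ => ?_⟩
  · refine tendsto_nhds_unique ((hf.tendsto z).comp hz) (tendsto_iff_dist_tendsto_zero.mpr ?_)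
    exact squeeze_zero (fun _ => dist_nonneg) (fun n => hfu (φ n)) hlim
  · obtain ⟨n, hn, hnz⟩ := ((hlim.eventually_lt_const (half_pos hδ)).and
      (Metric.tendsto_nhds.mp hz (δ / 2) (half_pos hδ))).exists
    rw [← add_halves δ]
    exact transGen_chainStep_of_dist_le (half_pos hδ).le
      (TransGen.mono (fun _ _ => ChainStep.mono hn.le) _ _ (hu (φ n))) hnz.le

theorem chainComponents_eq_setOf {C : Set X} (hC : C ∈ chainComponents f) :
    ∃ a ∈ C, C = {y | ChainReach f a y ∧ ChainReach f y a} := by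
  obtain ⟨a, ha, rfl⟩ := hC
  refine ⟨a, ⟨ha, ha, ha⟩, Set.ext fun y => ⟨fun h => h.2, fun h => ⟨h.2.trans h.1, h⟩⟩⟩

theorem isClosed_of_mem_chainComponents (hf : Continuous f) {C : Set X}
    (hC : C ∈ chainComponents f) : IsClosed C := by
  obtain ⟨a, -, rfl⟩ := chainComponents_eq_setOf hC
  exact (isClosed_setOf_chainReach_right a).inter (isClosed_setOf_chainReach_left hf a)

theorem subset_image_of_mem_chainComponents [CompactSpace X] (hf : Continuous f) {C : Set X}
    (hC : C ∈ chainComponents f) : C ⊆ f '' C := by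
  obtain ⟨a, -, rfl⟩ := chainComponents_eq_setOf hC
  rintro y ⟨hay, hya⟩
  obtain ⟨z, rfl, hz⟩ := exists_apply_eq_chainReach hf (hya.trans hay)
  exact ⟨z, ⟨hay.trans hz, (chainReach_apply z).trans hya⟩, rfl⟩

/-- Under a ball expanding map, points near a set `C ⊆ f '' C` have backward orbits
converging to `C` geometrically. -/
theorem BallExpandingWith.exists_iterate_eq {L δ₀ : ℝ} (hL0 : 0 < L) (hL1 : L < 1)
    (hδ₀ : 0 < δ₀) (hbe : BallExpandingWith f L δ₀) {C : Set X} (hC : C ⊆ f '' C) {x p : X}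
    (hp : p ∈ C) (hxp : dist x p ≤ δ₀) (n : ℕ) :
    ∃ w, ∃ q ∈ C, dist w q ≤ L ^ n * δ₀ ∧ f^[n] w = x := by
  induction n with
  | zero => exact ⟨x, p, hp, by simpa using hxp, rfl⟩
  | succ n ih =>
    obtain ⟨w, q, hq, hwq, rfl⟩ := ih
    obtain ⟨r, hr, rfl⟩ := hC hq
    obtain ⟨v, hv, rfl⟩ := hbe r (L ^ n * δ₀) (by positivity)
      (mul_le_of_le_one_left hδ₀.le (pow_le_one₀ hL0.le hL1.le)) (mem_closedBall.mpr hwq)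
    refine ⟨v, r, hr, ?_, iterate_succ_apply f n v⟩
    rw [pow_succ', mul_assoc]
    exact hv

end ChainReach

/-- Lemma 1.1: if `f` is ball expanding with constants `L`, `δ₀`, `C` is a chain component,
`d(x, C) ≤ δ₀` and `d(f^i(x), C) → 0`, then `x ∈ C`. -/
theorem mem_chainComponent_of_ballExpanding {X : Type*} [MetricSpace X] [CompactSpace X]
    (f : X → X) (hf : Continuous f) {L δ₀ : ℝ} (hL0 : 0 < L) (hL1 : L < 1) (hδ₀ : 0 < δ₀)
    (hbe : BallExpandingWith f L δ₀)
    {C : Set X} (hC : C ∈ chainComponents f) {x : X}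
    (hd : infDist x C ≤ δ₀)
    (hlim : Filter.Tendsto (fun i : ℕ => infDist (f^[i] x) C) Filter.atTop (nhds 0)) :
    x ∈ C := by
  obtain ⟨a, haC, hCa⟩ := chainComponents_eq_setOf hC
  have himage := subset_image_of_mem_chainComponents hf hC
  have hmem : ∀ {y}, y ∈ C → ChainReach f a y ∧ ChainReach f y a := fun hy => by
    rwa [hCa] at hy
  rw [hCa]
  constructor <;> refine chainReach_iff_transGen.mpr fun δ hδ => ?_
  · obtain ⟨p, hp, hxp⟩ :=
      (isClosed_of_mem_chainComponents hf hC).isCompact.exists_infDist_eq_dist ⟨a, haC⟩ x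
    obtain ⟨n, hn⟩ := exists_pow_lt_of_lt_one (div_pos hδ hδ₀) hL1
    obtain ⟨w, q, hq, hwq, rfl⟩ :=
      hbe.exists_iterate_eq hL0 hL1 hδ₀ himage hp (hxp ▸ hd) n
    obtain ⟨r, hr, rfl⟩ := himage hq
    refine ((chainReach_iff_transGen.mp (hmem hr).1 δ hδ).tail ?_).trans_left
      (reflTransGen_chainStep_iterate hδ.le w n)
    rw [dist_comm] at hwq
    exact hwq.trans ((lt_div_iff₀ hδ₀).mp hn).le
  · obtain ⟨i, hi, hi1⟩ := ((hlim.eventually_lt_const hδ).and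
      (Filter.eventually_ge_atTop 1)).exists
    obtain ⟨p, hp, hip⟩ := (infDist_lt_iff ⟨a, haC⟩).mp hi
    obtain ⟨j, rfl⟩ := Nat.exists_eq_add_of_le' hi1
    rw [iterate_succ_apply'] at hip
    exact (Relation.TransGen.tail' (reflTransGen_chainStep_iterate hδ.le x j) hip.le).trans
      (chainReach_iff_transGen.mp (hmem hp).2 δ hδ)
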